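/- arXiv:2506.18540 — 6 statements merged into one kernel-verified Lean document; each statement's English description precedes it below -/
import Mathlib

section
/- Suppose a voting configuration (v_ch, v_pr, l_ch, l_pr) on 5 parties satisfies the constraints. Then for every party q ∈ Fin 5, l_pr^q · l_ch^q = 0 (no party can be chancellor and president simultaneously). -/
open Finset

/-- A voting configuration on 5 parties: binary chancellor/president votes
`vch q k`, `vpr q k` (vote of party `q` for party `k`; the diagonal is
normalized to `0` since only pairs with `k ≠ q` carry a vote), and binary
labels `lch q` (is `q` chancellor?) and `lpr q` (is `q` president?). -/
structure Config where
  vch : Fin 5 → Fin 5 → ℕ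
  vpr : Fin 5 → Fin 5 → ℕ
  lch : Fin 5 → ℕ
  lpr : Fin 5 → ℕ
  vch_le : ∀ q k, vch q k ≤ 1
  vpr_le : ∀ q k, vpr q k ≤ 1
  lch_le : ∀ q, lch q ≤ 1
  lpr_le : ∀ q, lpr q ≤ 1
  vch_diag : ∀ q, vch q q = 0
  vpr_diag : ∀ q, vpr q q = 0

/-- The constraints (i)–(iv) on a voting configuration. -/
def Config.Satisfies (c : Config) : Prop :=
  (∀ q, ∑ k ∈ univ.filter (· ≠ q), c.vch q k ≤ 1) ∧
  (∀ q, ∑ k ∈ univ.filter (· ≠ q), c.vpr q k ≤ c.lch q) ∧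
  (∀ q, (c.lch q = 1 ↔ 3 ≤ ∑ k ∈ univ.filter (· ≠ q), c.vch k q)) ∧
  (∀ q, c.lpr q = ∑ k ∈ univ.filter (· ≠ q),
      c.vpr k q *
        (if 3 ≤ ∑ q' ∈ univ.filter (fun x => x ≠ k ∧ x ≠ q), c.vch q' k then 1 else 0))

/-- A party's chancellor votes for two distinct candidates total at most one. -/
theorem Config.Satisfies.vch_add_vch_le {c : Config} (hc : c.Satisfies) {q k : Fin 5}
    (hkq : k ≠ q) (x : Fin 5) : c.vch x q + c.vch x k ≤ 1 := by
  have hsum : ∑ j ∈ univ.filter (· ≠ x), c.vch x j = ∑ j, c.vch x j := by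
    refine sum_subset (subset_univ _) fun j _ hj => ?_
    obtain rfl : j = x := by simpa using hj
    exact c.vch_diag j
  calc c.vch x q + c.vch x k = ∑ j ∈ {q, k}, c.vch x j := (sum_pair hkq.symm).symm
    _ ≤ ∑ j, c.vch x j := sum_le_sum_of_subset (subset_univ _)
    _ ≤ 1 := hsum ▸ hc.1 x

/-- Two distinct parties cannot both receive a majority of the chancellor votes. -/
theorem Config.Satisfies.not_two_majorities {c : Config} (hc : c.Satisfies) {q k : Fin 5}
    (hkq : k ≠ q) (hq : 3 ≤ ∑ x, c.vch x q) : ¬ 3 ≤ ∑ x, c.vch x k := by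
  have htotal : ∑ x, (c.vch x q + c.vch x k) ≤ ∑ _x : Fin 5, 1 :=
    sum_le_sum fun x _ => hc.vch_add_vch_le hkq x
  simp only [sum_add_distrib, sum_const, card_univ, Fintype.card_fin, smul_eq_mul] at htotal
  omega

/-- No party can be chancellor and president simultaneously. -/
theorem no_one_in_two_positions (c : Config) (hc : c.Satisfies) :
    ∀ q : Fin 5, c.lpr q * c.lch q = 0 := by
  intro q
  by_cases hq : c.lch q = 1
  · have hmajority : 3 ≤ ∑ x, c.vch x q :=
      ((hc.2.2.1 q).1 hq).trans (sum_le_sum_of_subset (subset_univ _))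
    have hlpr : c.lpr q = 0 := by
      rw [hc.2.2.2 q]
      refine sum_eq_zero fun k hk => ?_
      have hkq : k ≠ q := (mem_filter.1 hk).2
      rw [if_neg fun h => hc.not_two_majorities hkq hmajority
        (h.trans (sum_le_sum_of_subset (subset_univ _))), mul_zero]
    rw [hlpr, zero_mul]
  · have hlch : c.lch q = 0 := by
      have := c.lch_le q
      omega
    rw [hlch, mul_zero]
end

section
/- Suppose a voting configuration (v_ch, v_pr, l_ch, l_pr) on 5 parties satisfies the constraints. Then the set {q ∈ Fin 5 | l_pr^q = 1} has cardinality at most 1 (there can be at most one president). -/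
open Finset

/-- Each party casts at most one chancellor vote, the (null) diagonal entry included. -/
lemma Config.Satisfies.sum_vch_le_one {c : Config} (hc : c.Satisfies) (q : Fin 5) :
    ∑ k, c.vch q k ≤ 1 := by
  have h := hc.1 q
  rwa [filter_ne', sum_erase _ (c.vch_diag q)] at h

/-- At most one party receives at least three chancellor votes. -/
lemma Config.Satisfies.eq_of_three_le {c : Config} (hc : c.Satisfies) {k l : Fin 5}
    (hk : 3 ≤ ∑ q, c.vch q k) (hl : 3 ≤ ∑ q, c.vch q l) : k = l := by
  by_contra hne
  have h : ∑ q, (c.vch q k + c.vch q l) ≤ ∑ _q : Fin 5, 1 := by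
    refine sum_le_sum fun q _ => le_trans ?_ (hc.sum_vch_le_one q)
    rw [← sum_pair hne]
    exact sum_le_sum_of_subset (subset_univ _)
  rw [sum_add_distrib] at h
  simp only [sum_const, card_univ, Fintype.card_fin, smul_eq_mul] at h
  omega

/-- A president is voted for by a party holding at least three chancellor votes. -/
lemma Config.Satisfies.exists_voter {c : Config} (hc : c.Satisfies) {q : Fin 5}
    (hq : c.lpr q = 1) : ∃ k, 1 ≤ c.vpr k q ∧ 3 ≤ ∑ p, c.vch p k := by
  have hne : c.lpr q ≠ 0 := by omega
  rw [hc.2.2.2 q] at hne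
  obtain ⟨k, -, hk⟩ := exists_ne_zero_of_sum_ne_zero hne
  obtain ⟨hv, hi⟩ := mul_ne_zero_iff.mp hk
  refine ⟨k, Nat.one_le_iff_ne_zero.mpr hv, ?_⟩
  exact (of_not_not fun h => hi (if_neg h)).trans (sum_le_sum_of_subset (subset_univ _))

/-- Each party casts at most one president vote, the (null) diagonal entry included. -/
lemma Config.Satisfies.sum_vpr_le_one {c : Config} (hc : c.Satisfies) (q : Fin 5) :
    ∑ k, c.vpr q k ≤ 1 := by
  have h := (hc.2.1 q).trans (c.lch_le q)
  rwa [filter_ne', sum_erase _ (c.vpr_diag q)] at h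

/-- There can be at most one president. -/
theorem at_most_one_president (c : Config) (hc : c.Satisfies) :
    (univ.filter (fun q : Fin 5 => c.lpr q = 1)).card ≤ 1 := by
  refine card_le_one.mpr fun a ha b hb => ?_
  obtain ⟨k, hka, hk⟩ := hc.exists_voter (mem_filter.mp ha).2
  obtain ⟨l, hlb, hl⟩ := hc.exists_voter (mem_filter.mp hb).2
  obtain rfl := hc.eq_of_three_le hk hl
  by_contra hne
  have h : ∑ p ∈ {a, b}, c.vpr k p ≤ 1 :=
    (sum_le_sum_of_subset (subset_univ _)).trans (hc.sum_vpr_le_one k)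
  rw [sum_pair hne] at h
  omega
end

section
/- Let i be a bifurcation choice belonging to I_lost, i.e. for every party q ∈ Fin 5, the number of parties q' ≠ q with i_lost^{q'} = q is strictly less than 3. Then every voting configuration (v_ch, v_pr, l_ch, l_pr) compatible with i satisfies l_ch^q = 0 and l_pr^q = 0 for every q (everyone lost). -/
open Finset

/-- A bifurcation choice: for each party `q`, a party `ilost q ≠ q`
(its chancellor vote if it lost) and a party `ich q ≠ q`
(its president vote if it is chancellor). -/
structure Bif where
  ilost : Fin 5 → Fin 5
  ich : Fin 5 → Fin 5
  ilost_ne : ∀ q, ilost q ≠ q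
  ich_ne : ∀ q, ich q ≠ q

/-- Compatibility of a voting configuration with a bifurcation choice. -/
def Compatible (c : Config) (i : Bif) : Prop :=
  c.Satisfies ∧
  (∀ q, ¬ (c.lch q = 1 ∧ c.lpr q = 1)) ∧
  (∀ q k, k ≠ q →
    ((c.lch q = 0 ∧ c.lpr q = 0) →
      c.vch q k = (if k = i.ilost q then 1 else 0) ∧ c.vpr q k = 0) ∧
    ((c.lch q = 1 ∧ c.lpr q = 0) →
      c.vch q k = 0 ∧ c.vpr q k = (if k = i.ich q then 1 else 0)) ∧
    ((c.lch q = 0 ∧ c.lpr q = 1) →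
      c.vch q k = 0 ∧ c.vpr q k = 0))

/-- `I_lost`: every party receives strictly fewer than 3 lost-votes. -/
def ILost (i : Bif) : Prop :=
  ∀ q : Fin 5, (univ.filter (fun q' => q' ≠ q ∧ i.ilost q' = q)).card < 3

/-- `I_ch^q`: exactly 3 parties lost-vote for `q`, and the party `q` would
president-vote for lost-votes for `q`. -/
def ICh (q : Fin 5) (i : Bif) : Prop :=
  (univ.filter (fun q' => q' ≠ q ∧ i.ilost q' = q)).card = 3 ∧ i.ilost (i.ich q) = q

/-- `I_pr^{q,q'}`: at least 3 parties outside `{q, q'}` lost-vote for `q`,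
and `q` would president-vote for `q'`. -/
def IPr (q q' : Fin 5) (i : Bif) : Prop :=
  3 ≤ (univ.filter (fun k => k ≠ q ∧ k ≠ q' ∧ i.ilost k = q)).card ∧ i.ich q = q'

/-- In a compatible configuration a chancellor vote for another party can only be
the lost-vote of the bifurcation choice. -/
theorem Compatible.vch_le_ite {c : Config} {i : Bif} (hc : Compatible c i) {k q : Fin 5}
    (hkq : k ≠ q) : c.vch k q ≤ if i.ilost k = q then 1 else 0 := by
  obtain ⟨-, hnot, hcomp⟩ := hc
  obtain ⟨hlost, hchan, hpres⟩ := hcomp k q hkq.symm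
  have hch : c.lch k = 0 ∨ c.lch k = 1 := by have := c.lch_le k; omega
  have hpr : c.lpr k = 0 ∨ c.lpr k = 1 := by have := c.lpr_le k; omega
  rcases hch with h₁ | h₁ <;> rcases hpr with h₂ | h₂
  · simp [(hlost ⟨h₁, h₂⟩).1, eq_comm]
  · simp [(hpres ⟨h₁, h₂⟩).1]
  · simp [(hchan ⟨h₁, h₂⟩).1]
  · exact absurd ⟨h₁, h₂⟩ (hnot k)

/-- The number of chancellor votes for `q` is at most the number of lost-votes for `q`. -/
theorem Compatible.sum_vch_le_card {c : Config} {i : Bif} (hc : Compatible c i) (q : Fin 5) :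
    ∑ k ∈ univ.filter (· ≠ q), c.vch k q ≤
      (univ.filter (fun k => k ≠ q ∧ i.ilost k = q)).card := by
  rw [← filter_filter, card_filter]
  exact sum_le_sum fun k hk => hc.vch_le_ite (mem_filter.mp hk).2

/-- Without a chancellor there is no president. -/
theorem Config.Satisfies.lpr_eq_zero {c : Config} (hc : c.Satisfies)
    (hch : ∀ q, c.lch q = 0) (q : Fin 5) : c.lpr q = 0 := by
  obtain ⟨-, hvpr, -, hlpr⟩ := hc
  rw [hlpr q]
  refine sum_eq_zero fun k hk => ?_
  have hsum : ∑ j ∈ univ.filter (· ≠ k), c.vpr k j = 0 :=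
    Nat.le_zero.mp (hch k ▸ hvpr k)
  have hzero : c.vpr k q = 0 :=
    sum_eq_zero_iff.mp hsum q (by simpa [eq_comm] using hk)
  rw [hzero, zero_mul]

/-- If the bifurcation choice lies in I_lost, then in any compatible
configuration everyone lost. -/
theorem ILost_everyone_lost (i : Bif) (hi : ILost i)
    (c : Config) (hc : Compatible c i) :
    ∀ q : Fin 5, c.lch q = 0 ∧ c.lpr q = 0 := by
  have hch : ∀ q, c.lch q = 0 := by
    intro q
    have hne : c.lch q ≠ 1 := fun h =>
      absurd (((hc.1.2.2.1 q).mp h).trans (hc.sum_vch_le_card q)) (not_le.mpr (hi q))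
    have := c.lch_le q
    omega
  exact fun q => ⟨hch q, hc.1.lpr_eq_zero hch q⟩
end

section
/- Let i be a bifurcation choice belonging to I_lost, i.e. for every party q ∈ Fin 5, the number of parties q' ≠ q with i_lost^{q'} = q is strictly less than 3. Then there exists exactly one voting configuration compatible with i, namely the one with l_ch ≡ 0, l_pr ≡ 0, v_pr ≡ 0, and v_ch^{q→k} = [k = i_lost^q] for all q and k ≠ q. -/
open Finset

/-- A chancellor vote is cast only for the lost-vote target. -/
theorem Compatible.vch_le_ilost {c : Config} {i : Bif} (h : Compatible c i) {q k : Fin 5}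
    (hk : k ≠ q) : c.vch q k ≤ if i.ilost q = k then 1 else 0 := by
  obtain ⟨-, hne, hvote⟩ := h
  have h₁ := c.lch_le q
  have h₂ := c.lpr_le q
  have h₃ := hne q
  obtain ⟨hlost, hch, hpr⟩ := hvote q k hk
  rcases Nat.le_one_iff_eq_zero_or_eq_one.mp h₁ with a | a <;>
    rcases Nat.le_one_iff_eq_zero_or_eq_one.mp h₂ with b | b
  · rw [(hlost ⟨a, b⟩).1]
    simp only [eq_comm, le_refl]
  · simp [(hpr ⟨a, b⟩).1]
  · simp [(hch ⟨a, b⟩).1]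
  · exact absurd ⟨a, b⟩ h₃

/-- The lost-votes for `q`, counted as a sum of indicators. -/
theorem ILost.sum_lt {i : Bif} (hi : ILost i) (q : Fin 5) :
    ∑ k ∈ univ.filter (· ≠ q), (if i.ilost k = q then 1 else 0) < 3 := by
  rw [← card_filter, filter_filter]
  exact hi q

/-- In a configuration compatible with a choice in `I_lost`, everyone lost. -/
theorem Compatible.eq_of_iLost {c : Config} {i : Bif} (h : Compatible c i) (hi : ILost i) :
    (∀ q : Fin 5, c.lch q = 0) ∧ (∀ q : Fin 5, c.lpr q = 0) ∧
    (∀ q k : Fin 5, c.vpr q k = 0) ∧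
    (∀ q k : Fin 5, k ≠ q → c.vch q k = (if k = i.ilost q then 1 else 0)) := by
  have hlch : ∀ q, c.lch q = 0 := fun q => by
    have hlt : ∑ k ∈ univ.filter (· ≠ q), c.vch k q < 3 :=
      (sum_le_sum fun k hk => h.vch_le_ilost (mem_filter.mp hk).2.symm).trans_lt (hi.sum_lt q)
    have hiff := h.1.2.2.1 q
    have hle := c.lch_le q
    lia
  have hvpr : ∀ q k, c.vpr q k = 0 := fun q k => by
    rcases eq_or_ne k q with rfl | hk
    · exact c.vpr_diag k
    · have hsum := h.1.2.1 q
      rw [hlch q, Nat.le_zero, sum_eq_zero_iff] at hsum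
      exact hsum k (mem_filter.mpr ⟨mem_univ k, hk⟩)
  have hlpr : ∀ q, c.lpr q = 0 := fun q => by
    rw [h.1.2.2.2 q]
    simp [hvpr]
  exact ⟨hlch, hlpr, hvpr, fun q k hk => ((h.2.2 q k hk).1 ⟨hlch q, hlpr q⟩).1⟩

/-- The configuration in which everyone lost and casts the lost-vote of `i`. -/
def Bif.lostConfig (i : Bif) : Config where
  vch q k := if k = i.ilost q then 1 else 0
  vpr _ _ := 0
  lch _ := 0
  lpr _ := 0
  vch_le q k := by split <;> simp
  vpr_le _ _ := zero_le_one
  lch_le _ := zero_le_one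
  lpr_le _ := zero_le_one
  vch_diag q := if_neg (i.ilost_ne q).symm
  vpr_diag _ := rfl

theorem ILost.compatible_lostConfig {i : Bif} (hi : ILost i) : Compatible i.lostConfig i := by
  refine ⟨⟨fun q => ?_, fun q => ?_, fun q => ?_, fun q => ?_⟩, fun q => ?_, fun q k _ => ?_⟩
  · simp only [Bif.lostConfig, sum_ite_eq']
    split <;> simp
  · simp [Bif.lostConfig]
  · have hlt := hi.sum_lt q
    simp only [Bif.lostConfig, eq_comm (a := q)]
    lia
  · simp [Bif.lostConfig]
  · simp [Bif.lostConfig]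
  · simp [Bif.lostConfig]

/-- If the bifurcation choice lies in I_lost, there is exactly one compatible
configuration, namely the one where everyone lost and only the chancellor
lost-votes are cast. -/
theorem ILost_unique_config (i : Bif) (hi : ILost i) :
    (∃! c : Config, Compatible c i) ∧
    (∀ c : Config, Compatible c i →
      (∀ q : Fin 5, c.lch q = 0) ∧ (∀ q : Fin 5, c.lpr q = 0) ∧
      (∀ q k : Fin 5, c.vpr q k = 0) ∧
      (∀ q k : Fin 5, k ≠ q → c.vch q k = (if k = i.ilost q then 1 else 0))) := by
  refine ⟨⟨i.lostConfig, hi.compatible_lostConfig, fun c hc => ?_⟩,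
    fun c hc => hc.eq_of_iLost hi⟩
  obtain ⟨hlch, hlpr, hvpr, hvch⟩ := hc.eq_of_iLost hi
  have hvch' : c.vch = i.lostConfig.vch := by
    funext q k
    rcases eq_or_ne k q with rfl | hk
    · rw [c.vch_diag, i.lostConfig.vch_diag]
    · exact hvch q k hk
  have hvpr' : c.vpr = i.lostConfig.vpr := funext₂ hvpr
  have hlch' : c.lch = i.lostConfig.lch := funext hlch
  have hlpr' : c.lpr = i.lostConfig.lpr := funext hlpr
  cases c
  simp only [Bif.lostConfig] at hvch' hvpr' hlch' hlpr' ⊢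
  subst hvch' hvpr' hlch' hlpr'
  rfl
end

section
/- Fix distinct parties q, q' ∈ Fin 5 and let i be a bifurcation choice belonging to I_pr^{q,q'}, i.e. the number of parties k ∉ {q, q'} with i_lost^k = q is at least 3, and i_ch^q = q'. Then every voting configuration (v_ch, v_pr, l_ch, l_pr) compatible with i satisfies l_ch^k = [k = q] and l_pr^k = [k = q'] for every k ∈ Fin 5 (q is the chancellor and q' is the president). -/
open Finset

theorem card_filter_ne_ne {q q' : Fin 5} (hqq : q ≠ q') :
    (univ.filter (fun k : Fin 5 => k ≠ q ∧ k ≠ q')).card = 3 := by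
  revert q q'
  decide

/-- All three parties outside `{q, q'}` cast their lost-vote for `q`. -/
theorem IPr.ilost_eq {q q' : Fin 5} (hqq : q ≠ q') {i : Bif} (hi : IPr q q' i)
    (k : Fin 5) (hk : k ≠ q) (hk' : k ≠ q') : i.ilost k = q := by
  have hsub : univ.filter (fun k => k ≠ q ∧ k ≠ q' ∧ i.ilost k = q) ⊆
      univ.filter (fun k => k ≠ q ∧ k ≠ q') := fun k hk => by simp_all
  have heq := eq_of_subset_of_card_le hsub ((card_filter_ne_ne hqq).trans_le hi.1)
  have hmem : k ∈ univ.filter (fun k => k ≠ q ∧ k ≠ q' ∧ i.ilost k = q) := by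
    rw [heq]
    simp [hk, hk']
  exact (mem_filter.mp hmem).2.2.2

/-- A party that is not chancellor casts no president vote. -/
theorem Config.Satisfies.vpr_eq_zero {c : Config} (hc : c.Satisfies) {k : Fin 5}
    (hk : c.lch k = 0) (p : Fin 5) : c.vpr k p = 0 := by
  by_cases hp : p = k
  · rw [hp, c.vpr_diag]
  · have hsum := hc.2.1 k
    rw [hk, Nat.le_zero, sum_eq_zero_iff] at hsum
    exact hsum p (by simpa using hp)

/-- A chancellor vote can only go to the party designated by `ilost`. -/
theorem Compatible.vch_eq_zero {c : Config} {i : Bif} (hc : Compatible c i) {k p : Fin 5}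
    (hp : p ≠ i.ilost k) : c.vch k p = 0 := by
  by_cases hpk : p = k
  · rw [hpk, c.vch_diag]
  obtain ⟨h00, h10, h01⟩ := hc.2.2 k p hpk
  have h11 := hc.2.1 k
  rw [if_neg hp] at h00
  rcases Nat.le_one_iff_eq_zero_or_eq_one.mp (c.lch_le k) with h | h <;>
    rcases Nat.le_one_iff_eq_zero_or_eq_one.mp (c.lpr_le k) with h' | h'
  · exact (h00 ⟨h, h'⟩).1
  · exact (h01 ⟨h, h'⟩).1
  · exact (h10 ⟨h, h'⟩).1
  · exact absurd ⟨h, h'⟩ h11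

/-- If all parties outside `{q, q'}` lost-vote for `q`, no other party can be chancellor. -/
theorem Compatible.lch_eq_zero {c : Config} {i : Bif} (hc : Compatible c i) {q q' p : Fin 5}
    (hrest : ∀ k, k ≠ q → k ≠ q' → i.ilost k = q) (hp : p ≠ q) : c.lch p = 0 := by
  have hle : ∑ k ∈ univ.filter (· ≠ p), c.vch k p ≤ 2 := calc
    _ ≤ ∑ k, c.vch k p := sum_le_sum_of_subset (filter_subset _ _)
    _ = ∑ k ∈ {q, q'}, c.vch k p := by
      refine (sum_subset (subset_univ _) fun k _ hk => hc.vch_eq_zero ?_).symm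
      simp only [mem_insert, mem_singleton, not_or] at hk
      rwa [hrest k hk.1 hk.2]
    _ ≤ ∑ k ∈ ({q, q'} : Finset (Fin 5)), 1 := sum_le_sum fun k _ => c.vch_le k p
    _ ≤ 2 := by
      rw [← card_eq_sum_ones]
      exact card_le_two
  have hiff := hc.1.2.2.1 p
  have := c.lch_le p
  omega

/-- If the bifurcation choice lies in I_pr^{q,q'}, then in any compatible
configuration, q is the chancellor and q' is the president. -/
theorem IPr_chancellor_president (q q' : Fin 5) (hqq : q ≠ q')
    (i : Bif) (hi : IPr q q' i) (c : Config) (hc : Compatible c i) :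
    (∀ k : Fin 5, c.lch k = (if k = q then 1 else 0)) ∧
    (∀ k : Fin 5, c.lpr k = (if k = q' then 1 else 0)) := by
  have hrest := IPr.ilost_eq hqq hi
  have hcard := card_filter_ne_ne hqq
  have hne : ∀ p, p ≠ q → c.lch p = 0 := fun p hp => hc.lch_eq_zero hrest hp
  have hlost : ∀ k, k ≠ q → c.lpr k = 0 → c.vch k q = if i.ilost k = q then 1 else 0 := by
    intro k hk h
    rw [((hc.2.2 k q hk.symm).1 ⟨hne k hk, h⟩).1]
    simp only [eq_comm]
  have hvotes : (∀ k, k ≠ q → k ≠ q' → c.lpr k = 0) →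
      ∑ k ∈ univ.filter (fun k => k ≠ q ∧ k ≠ q'), c.vch k q = 3 := by
    intro h
    rw [← hcard, card_eq_sum_ones]
    refine sum_congr rfl fun k hk => ?_
    obtain ⟨hkq, hkq'⟩ := (mem_filter.mp hk).2
    rw [hlost k hkq (h k hkq hkq'), if_pos (hrest k hkq hkq')]
  have hq : c.lch q = 1 := by
    by_contra h
    have h0 : ∀ k, c.lch k = 0 := by
      intro k
      by_cases hk : k = q
      · subst hk
        have := c.lch_le k
        omega
      · exact hne k hk
    have hpr : ∀ k, c.lpr k = 0 := by
      intro k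
      rw [hc.1.2.2.2 k]
      exact sum_eq_zero fun j _ => by rw [hc.1.vpr_eq_zero (h0 j), zero_mul]
    refine h ((hc.1.2.2.1 q).2 ?_)
    rw [← hvotes fun k _ _ => hpr k]
    exact sum_le_sum_of_subset fun k hk => by simp_all
  have hqpr : c.lpr q = 0 := by
    have h1 := hc.2.1 q
    have h2 := c.lpr_le q
    by_contra h3
    exact h1 ⟨hq, by omega⟩
  have hvpr : ∀ p, p ≠ q → c.vpr q p = if p = q' then 1 else 0 := by
    intro p hp
    rw [((hc.2.2 q p hp).2.1 ⟨hq, hqpr⟩).2, hi.2]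
  have hpr_zero : ∀ p, p ≠ q → p ≠ q' → c.lpr p = 0 := by
    intro p hp hp'
    rw [hc.1.2.2.2 p]
    refine sum_eq_zero fun j _ => ?_
    by_cases hj : j = q
    · rw [hj, hvpr p hp, if_neg hp', zero_mul]
    · rw [hc.1.vpr_eq_zero (hne j hj), zero_mul]
  have hq' : c.lpr q' = 1 := by
    rw [hc.1.2.2.2 q', sum_eq_single q]
    · rw [hvpr q' hqq.symm, if_pos rfl, hvotes hpr_zero]
      simp
    · intro j _ hj
      rw [hc.1.vpr_eq_zero (hne j hj), zero_mul]
    · intro h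
      exact absurd (by simpa using hqq) h
  refine ⟨fun k => ?_, fun k => ?_⟩
  · split_ifs with h
    · rw [h, hq]
    · exact hne k h
  · split_ifs with h
    · rw [h, hq']
    · by_cases hk : k = q
      · rw [hk, hqpr]
      · exact hpr_zero k hk h
end

section
/- For every bifurcation choice i = (i_lost, i_ch), there exists exactly one voting configuration (v_ch, v_pr, l_ch, l_pr) compatible with i. (In the language of the paper: the choice relation Λ of the routed graph is a function, i.e. the routed graph is univocal.) -/
open Finset

/-- At least three parties lost-vote for `q`. -/
def Bif.Majority (i : Bif) (q : Fin 5) : Prop :=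
  3 ≤ ∑ k, if i.ilost k = q then 1 else 0

/-- Some majority party `q` president-votes for `p`, and every party outside `{q, p}`
lost-votes for `q`. -/
def Bif.President (i : Bif) (p : Fin 5) : Prop :=
  ∃ q, i.Majority q ∧ i.ich q = p ∧ ∀ k, k ≠ q → k ≠ p → i.ilost k = q

theorem Bif.Majority.unique {i : Bif} {q r : Fin 5} (hq : i.Majority q) (hr : i.Majority r) :
    q = r := by
  by_contra hne
  have h : ∑ k, ((if i.ilost k = q then 1 else 0) + (if i.ilost k = r then 1 else 0)) ≤
      ∑ _k : Fin 5, 1 := sum_le_sum fun k _ => by grind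
  rw [sum_add_distrib] at h
  simp only [Bif.Majority] at hq hr
  simp only [sum_const, card_univ, Fintype.card_fin, smul_eq_mul] at h
  omega

theorem Bif.President.not_majority {i : Bif} {p : Fin 5} (hp : i.President p) :
    ¬ i.Majority p := by
  intro hm
  obtain ⟨q, hq, rfl, -⟩ := hp
  exact i.ich_ne q (hm.unique hq)

theorem Bif.President.eq_ich {i : Bif} {p q : Fin 5} (hp : i.President p) (hq : i.Majority q) :
    p = i.ich q := by
  obtain ⟨r, hr, rfl, -⟩ := hp
  rw [hr.unique hq]

theorem three_le_sum_off_pair_iff {k p : Fin 5} (hkp : k ≠ p) {f : Fin 5 → ℕ}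
    (hf : ∀ x, f x ≤ 1) :
    3 ≤ ∑ x ∈ univ.filter (fun x => x ≠ k ∧ x ≠ p), f x ↔
      ∀ x, x ≠ k → x ≠ p → f x = 1 := by
  have hcard : (univ.filter (fun x => x ≠ k ∧ x ≠ p)).card = 3 := by
    revert k p; decide
  have hle : ∀ x ∈ univ.filter (fun x => x ≠ k ∧ x ≠ p), f x ≤ 1 := fun x _ => hf x
  have hsum := sum_le_sum hle
  have heq := sum_eq_sum_iff_of_le hle
  simp only [sum_const, hcard, smul_eq_mul, mul_one, mem_filter, mem_univ, true_and,
    and_imp] at hsum heq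
  rw [← heq]
  omega

theorem Bif.majority_of_sum {i : Bif} {q : Fin 5} {f : Fin 5 → ℕ}
    (hf : ∀ k, k ≠ q → f k ≤ if i.ilost k = q then 1 else 0)
    (h : 3 ≤ ∑ k ∈ univ.filter (· ≠ q), f k) : i.Majority q :=
  h.trans <| (sum_le_sum fun k hk => hf k (by simpa using hk)).trans <|
    sum_le_sum_of_subset (filter_subset _ _)

theorem Bif.Majority.sum_of_eq {i : Bif} {q : Fin 5} (hq : i.Majority q) {f : Fin 5 → ℕ}
    (hf : ∀ k, k ≠ q → f k = if i.ilost k = q then 1 else 0) :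
    3 ≤ ∑ k ∈ univ.filter (· ≠ q), f k := by
  rw [sum_congr rfl fun k hk => hf k (by simpa using hk)]
  refine hq.trans (le_of_eq (sum_filter_of_ne fun k _ hk => ?_).symm)
  rintro rfl
  exact hk (if_neg (i.ilost_ne k))

section Uniqueness

variable {c : Config} {i : Bif}

theorem Compatible.vch_eq (h : Compatible c i) {q k : Fin 5} (hk : k ≠ q) :
    c.vch q k = if c.lch q = 0 ∧ c.lpr q = 0 ∧ k = i.ilost q then 1 else 0 := by
  have := c.lch_le q
  have := c.lpr_le q
  have := h.2.1 q
  have := h.2.2 q k hk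
  grind

theorem Compatible.vpr_eq (h : Compatible c i) {q k : Fin 5} (hk : k ≠ q) :
    c.vpr q k = if c.lch q = 1 ∧ k = i.ich q then 1 else 0 := by
  have := c.lch_le q
  have := c.lpr_le q
  have := h.2.1 q
  have := h.2.2 q k hk
  grind

theorem Compatible.majority_of_lch (h : Compatible c i) {q : Fin 5} (hq : c.lch q = 1) :
    i.Majority q := by
  refine i.majority_of_sum (fun k hk => ?_) ((h.1.2.2.1 q).1 hq)
  rw [h.vch_eq hk.symm]
  grind

theorem Compatible.exists_of_lpr (h : Compatible c i) {p : Fin 5} (hp : c.lpr p = 1) :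
    ∃ k, k ≠ p ∧ c.lch k = 1 ∧ i.ich k = p ∧ ∀ x, x ≠ k → x ≠ p → c.vch x k = 1 := by
  have hsum := h.1.2.2.2 p
  rw [hp] at hsum
  obtain ⟨k, hk, hne⟩ := exists_ne_zero_of_sum_ne_zero (hsum ▸ one_ne_zero)
  have hk : k ≠ p := by simpa using hk
  have := three_le_sum_off_pair_iff hk fun x => c.vch_le x k
  rw [h.vpr_eq hk.symm] at hne
  grind

theorem Compatible.lch_iff (h : Compatible c i) (q : Fin 5) : c.lch q = 1 ↔ i.Majority q := by
  refine ⟨h.majority_of_lch, fun hq => ?_⟩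
  by_contra hne
  have hch : ∀ r, c.lch r ≠ 1 := fun r hr =>
    hne (hq.unique (h.majority_of_lch hr) ▸ hr)
  have hpr : ∀ r, c.lpr r ≠ 1 := fun r hr => by
    obtain ⟨k, -, hk, -⟩ := h.exists_of_lpr hr
    exact hch k hk
  refine hne ((h.1.2.2.1 q).2 (hq.sum_of_eq fun k hk => ?_))
  have := c.lch_le k
  have := c.lpr_le k
  have := hch k
  have := hpr k
  rw [h.vch_eq hk.symm]
  grind

theorem Compatible.lpr_iff (h : Compatible c i) (p : Fin 5) : c.lpr p = 1 ↔ i.President p := by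
  constructor
  · intro hp
    obtain ⟨k, -, hk, hich, hall⟩ := h.exists_of_lpr hp
    refine ⟨k, h.majority_of_lch hk, hich, fun x hxk hxp => ?_⟩
    have := hall x hxk hxp
    rw [h.vch_eq hxk.symm] at this
    grind
  · rintro ⟨q, hq, rfl, hall⟩
    have hlq := (h.lch_iff q).2 hq
    have hqp := (i.ich_ne q).symm
    have hv : ∀ x, x ≠ q → x ≠ i.ich q → c.vch x q = 1 := fun x hxq hxp => by
      have h1 : c.lch x ≠ 1 := fun hx => hxq ((h.majority_of_lch hx).unique hq)
      have h2 : c.lpr x ≠ 1 := fun hx => by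
        obtain ⟨k, -, hk, hich, -⟩ := h.exists_of_lpr hx
        rw [(h.majority_of_lch hk).unique hq] at hich
        exact hxp hich.symm
      have := c.lch_le x
      have := c.lpr_le x
      have := hall x hxq hxp
      rw [h.vch_eq hxq.symm]
      grind
    refine le_antisymm (c.lpr_le _) ?_
    rw [h.1.2.2.2]
    refine le_trans ?_ (single_le_sum (fun _ _ => Nat.zero_le _) (a := q) (by simpa using hqp))
    rw [h.vpr_eq hqp.symm, if_pos ⟨hlq, rfl⟩,
      if_pos ((three_le_sum_off_pair_iff hqp fun x => c.vch_le x q).2 hv)]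

theorem Compatible.unique {d : Config} (hc : Compatible c i) (hd : Compatible d i) : c = d := by
  have hch : c.lch = d.lch := funext fun q => by
    have := c.lch_le q
    have := d.lch_le q
    have := (hc.lch_iff q).trans (hd.lch_iff q).symm
    omega
  have hpr : c.lpr = d.lpr := funext fun q => by
    have := c.lpr_le q
    have := d.lpr_le q
    have := (hc.lpr_iff q).trans (hd.lpr_iff q).symm
    omega
  have hvch : c.vch = d.vch := funext fun q => funext fun k => by
    obtain rfl | hk := eq_or_ne k q
    · rw [c.vch_diag, d.vch_diag]
    · rw [hc.vch_eq hk, hd.vch_eq hk, hch, hpr]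
  have hvpr : c.vpr = d.vpr := funext fun q => funext fun k => by
    obtain rfl | hk := eq_or_ne k q
    · rw [c.vpr_diag, d.vpr_diag]
    · rw [hc.vpr_eq hk, hd.vpr_eq hk, hch]
  cases c
  cases d
  simp_all

end Uniqueness

open Classical in
/-- The configuration in which the majority party is chancellor, its nominee is president if
all the remaining parties lost-vote for the chancellor, and everyone else lost. -/
noncomputable def Bif.config (i : Bif) : Config where
  vch q k := if ¬ i.Majority q ∧ ¬ i.President q ∧ k = i.ilost q then 1 else 0
  vpr q k := if i.Majority q ∧ k = i.ich q then 1 else 0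
  lch q := if i.Majority q then 1 else 0
  lpr q := if i.President q then 1 else 0
  vch_le q k := by split_ifs <;> simp
  vpr_le q k := by split_ifs <;> simp
  lch_le q := by split_ifs <;> simp
  lpr_le q := by split_ifs <;> simp
  vch_diag q := if_neg fun h => i.ilost_ne q h.2.2.symm
  vpr_diag q := if_neg fun h => i.ich_ne q h.2.symm

theorem Bif.config_vch_eq_one_iff (i : Bif) (q k : Fin 5) :
    i.config.vch q k = 1 ↔ ¬ i.Majority q ∧ ¬ i.President q ∧ k = i.ilost q := by
  simp [Bif.config]

theorem sum_le_one_of_eq {α : Type*} [DecidableEq α] (s : Finset α) {f : α → ℕ} {a : α}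
    (hf : ∀ k, f k ≤ if k = a then 1 else 0) : ∑ k ∈ s, f k ≤ 1 := by
  refine (sum_le_sum fun k _ => hf k).trans ?_
  rw [sum_ite_eq']
  split_ifs <;> simp

theorem Bif.config_satisfies (i : Bif) : i.config.Satisfies := by
  refine ⟨fun q => ?_, fun q => ?_, fun q => ⟨fun hq => ?_, fun hq => ?_⟩, fun p => ?_⟩
  · refine sum_le_one_of_eq _ (a := i.ilost q) fun k => ?_
    simp only [Bif.config]
    grind
  · by_cases hq : i.Majority q
    · refine (sum_le_one_of_eq _ (a := i.ich q) fun k => ?_).trans ?_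
      · simp only [Bif.config]
        grind
      · simp [Bif.config, hq]
    · simp [Bif.config, hq]
  · have hq : i.Majority q := by simpa [Bif.config] using hq
    have hmaj : ∀ k, k ≠ q → ¬ i.Majority k := fun k hk hm => hk (hm.unique hq)
    by_cases hp : i.President (i.ich q)
    · obtain ⟨r, hr, -, hall⟩ := hp
      obtain rfl := hr.unique hq
      have hsum := (three_le_sum_off_pair_iff (i.ich_ne r).symm
        fun x => i.config.vch_le x r).2 fun x hxr hxp =>
          (i.config_vch_eq_one_iff x r).2
            ⟨hmaj x hxr, fun hx => hxp (hx.eq_ich hr), (hall x hxr hxp).symm⟩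
      refine hsum.trans (sum_le_sum_of_subset fun x hx => ?_)
      simp only [mem_filter, mem_univ, true_and] at hx ⊢
      exact hx.1
    · refine hq.sum_of_eq fun k hk => ?_
      have h1 := hmaj k hk
      have h2 : ¬ i.President k := fun hx => hp (hx.eq_ich hq ▸ hx)
      simp [Bif.config, h1, h2, eq_comm]
  · have hm : i.Majority q := i.majority_of_sum (fun k _ => by simp only [Bif.config]; grind) hq
    simp [Bif.config, hm]
  · by_cases hq : ∃ q, i.Majority q ∧ i.ich q = p
    · obtain ⟨q, hq, rfl⟩ := hq
      have hqp := (i.ich_ne q).symm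
      rw [sum_eq_single_of_mem q (by simpa using hqp) fun k _ hk => by
        rw [show i.config.vpr k (i.ich q) = 0 from if_neg fun h => hk (h.1.unique hq), zero_mul]]
      rw [show i.config.vpr q (i.ich q) = 1 from if_pos ⟨hq, rfl⟩, one_mul]
      classical
      refine if_congr ?_ rfl rfl
      rw [three_le_sum_off_pair_iff hqp fun x => i.config.vch_le x q]
      constructor
      · rintro ⟨r, hr, -, hall⟩ x hxq hxp
        obtain rfl := hr.unique hq
        exact (i.config_vch_eq_one_iff x r).2
          ⟨fun hm => hxq (hm.unique hr), fun hx => hxp (hx.eq_ich hr), (hall x hxq hxp).symm⟩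
      · exact fun hall => ⟨q, hq, rfl, fun x hxq hxp =>
          ((i.config_vch_eq_one_iff x q).1 (hall x hxq hxp)).2.2.symm⟩
    · rw [sum_eq_zero fun k _ => by
        rw [show i.config.vpr k p = 0 from if_neg fun h => hq ⟨k, h.1, h.2.symm⟩, zero_mul]]
      exact if_neg fun ⟨q, h, hich, _⟩ => hq ⟨q, h, hich⟩

theorem Bif.config_compatible (i : Bif) : Compatible i.config i := by
  refine ⟨i.config_satisfies, fun q => ?_, fun q k _ => ?_⟩
  · have := @Bif.President.not_majority i q
    simp only [Bif.config]
    grind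
  · simp only [Bif.config]
    grind

/-- The choice relation is a function: for every bifurcation choice there is
exactly one compatible voting configuration (univocality of the routed graph). -/
theorem choice_relation_is_function (i : Bif) :
    ∃! c : Config, Compatible c i :=
  ⟨i.config, i.config_compatible, fun _ hc => hc.unique i.config_compatible⟩
end
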